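/- Let 1 < p < n, q = p/(p-1), and let f be a smooth compactly supported function on ℝ^n, not identically zero on ℝ^n_+. For every real t with (α_f^{1-q}/q)|t|^q ≤ 1, the slice of K_f at height t satisfies K_{f,t} = (1 − (α_f^{1-q}/q)|t|^q)^{1/q} · K_{f,0}, and K_{f,t} is empty when (α_f^{1-q}/q)|t|^q > 1. -/

import Mathlib

open MeasureTheory Real Set
open scoped RealInnerProductSpace ENNReal NNReal Pointwise

noncomputable section

namespace AffineTrace

/-- `ω s = π^(s/2) / Γ(s/2 + 1)` -/
def w (s : ℝ) : ℝ := Real.pi ^ (s / 2) / Real.Gamma (s / 2 + 1)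

/-- the constant `c_{m,p} = (m ω_m)^{1/m} (m ω_m ω_{p-1} / (2 ω_{m+p-2}))^{1/p}` -/
def cc (m : ℕ) (p : ℝ) : ℝ :=
  ((m : ℝ) * w m) ^ ((m : ℝ)⁻¹) *
    ((m : ℝ) * w m * w (p - 1) / (2 * w ((m : ℝ) + p - 2))) ^ p⁻¹

/-- the constant `a_{m,p} = ω_{m+p} / (ω_2 ω_m ω_{p-1})` -/
def aa (m : ℕ) (p : ℝ) : ℝ := w ((m : ℝ) + p) / (w 2 * w m * w (p - 1))

/-- the open half-space `ℝⁿ₊ = (0,∞) × ℝ^{n-1}` -/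
def H (n : ℕ) : Set (ℝ × EuclideanSpace ℝ (Fin (n - 1))) := {y | 0 < y.1}

/-- `∂f/∂t`, the partial derivative in the `t`-variable -/
def dt {n : ℕ} (f : ℝ × EuclideanSpace ℝ (Fin (n - 1)) → ℝ)
    (y : ℝ × EuclideanSpace ℝ (Fin (n - 1))) : ℝ :=
  fderiv ℝ f y (1, 0)

/-- `∇_ξ f = ∇̃f ⬝ ξ`, the directional derivative in the direction `(0, ξ)` -/
def dxi {n : ℕ} (f : ℝ × EuclideanSpace ℝ (Fin (n - 1)) → ℝ)
    (ξ : EuclideanSpace ℝ (Fin (n - 1))) (y : ℝ × EuclideanSpace ℝ (Fin (n - 1))) : ℝ :=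
  fderiv ℝ f y (0, ξ)

/-- `∇̃f`, the gradient in the `x`-variable -/
def gradx {n : ℕ} (f : ℝ × EuclideanSpace ℝ (Fin (n - 1)) → ℝ)
    (y : ℝ × EuclideanSpace ℝ (Fin (n - 1))) : EuclideanSpace ℝ (Fin (n - 1)) :=
  gradient (fun x => f (y.1, x)) y.2

/-- the `L^p` norm (w.r.t. Lebesgue measure) over the half-space `ℝⁿ₊` -/
def lp (n : ℕ) (p : ℝ) (g : ℝ × EuclideanSpace ℝ (Fin (n - 1)) → ℝ) : ℝ :=
  (∫ y in H n, |g y| ^ p) ^ p⁻¹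

/-- the surface measure on the unit sphere `𝕊^{m-1}` of `ℝ^m` -/
def sphMeasure (m : ℕ) : Measure (Metric.sphere (0 : EuclideanSpace ℝ (Fin m)) 1) :=
  (volume : Measure (EuclideanSpace ℝ (Fin m))).toSphere

/-- `Z_p(f) = (∫_{𝕊^{n-2}} ‖∇_ξ f‖_p^{1-n} dξ)^{1/(1-n)}` -/
def Z (n : ℕ) (p : ℝ) (f : ℝ × EuclideanSpace ℝ (Fin (n - 1)) → ℝ) : ℝ :=
  (∫ ξ, lp n p (dxi f (ξ : EuclideanSpace ℝ (Fin (n - 1)))) ^ (1 - (n : ℝ))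
      ∂(sphMeasure (n - 1))) ^ (1 - (n : ℝ))⁻¹

/-- the affine energy `ℰ_p(f) = c_{n-1,p} Z_p(f)` -/
def Ep (n : ℕ) (p : ℝ) (f : ℝ × EuclideanSpace ℝ (Fin (n - 1)) → ℝ) : ℝ :=
  cc (n - 1) p * Z n p f

/-- the boundary trace integral `∫_{∂ℝⁿ₊} |f(0,x)|^r dx` -/
def bdry (n : ℕ) (r : ℝ) (f : ℝ × EuclideanSpace ℝ (Fin (n - 1)) → ℝ) : ℝ :=
  ∫ x : EuclideanSpace ℝ (Fin (n - 1)), |f (0, x)| ^ r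

/-- the duality pairing on `ℝ × ℝ^m` -/
def pairP {m : ℕ} (y z : ℝ × EuclideanSpace ℝ (Fin m)) : ℝ := y.1 * z.1 + ⟪y.2, z.2⟫

/-- the Legendre transform of a function on `ℝ × ℝ^m` -/
def legendreP {m : ℕ} (C : ℝ × EuclideanSpace ℝ (Fin m) → ℝ)
    (y : ℝ × EuclideanSpace ℝ (Fin m)) : ℝ :=
  ⨆ z, (pairP y z - C z)

/-- the Legendre transform of a function on `ℝ^m` -/
def legendreE {m : ℕ} (C : EuclideanSpace ℝ (Fin m) → ℝ) (y : EuclideanSpace ℝ (Fin m)) : ℝ :=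
  ⨆ z, (⟪y, z⟫ - C z)

/-- the `m`-dimensional volume of a subset of `ℝ^m`, as a real number -/
def vol {m : ℕ} (K : Set (EuclideanSpace ℝ (Fin m))) : ℝ := (volume K).toReal

/-- the support function of a subset of `ℝ^m` -/
def suppFn {m : ℕ} (K : Set (EuclideanSpace ℝ (Fin m))) (y : EuclideanSpace ℝ (Fin m)) : ℝ :=
  sSup ((fun z => ⟪y, z⟫) '' K)

/-- the polar body of a subset of `ℝ^m` -/
def polar {m : ℕ} (K : Set (EuclideanSpace ℝ (Fin m))) : Set (EuclideanSpace ℝ (Fin m)) :=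
  {y | ∀ z ∈ K, ⟪y, z⟫ ≤ 1}

/-- the `L_p`-centroid body `Γ_p K` of a convex body `K ⊂ ℝ^m`: the convex body whose
support function is `h(y) = ((a_{m,p} vol K)⁻¹ ∫_K |⟨y,z⟩|^p dz)^{1/p}` -/
def centroid (m : ℕ) (p : ℝ) (K : Set (EuclideanSpace ℝ (Fin m))) :
    Set (EuclideanSpace ℝ (Fin m)) :=
  {x | ∀ y, ⟪x, y⟫ ≤ ((aa m p * vol K)⁻¹ * ∫ z in K, |⟪y, z⟫| ^ p) ^ p⁻¹}

/-- the convex body `L_f = {ξ : ‖∇_ξ f‖_p ≤ 1}` in `ℝ^{n-1}` -/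
def Lbody (n : ℕ) (p : ℝ) (f : ℝ × EuclideanSpace ℝ (Fin (n - 1)) → ℝ) :
    Set (EuclideanSpace ℝ (Fin (n - 1))) :=
  {ξ | lp n p (dxi f ξ) ≤ 1}

/-- the constant `α_f = (p/(p-1)) ‖∂f/∂t‖_p^{-p} Z_p(f)^{1-n}` -/
def alpha (n : ℕ) (p : ℝ) (f : ℝ × EuclideanSpace ℝ (Fin (n - 1)) → ℝ) : ℝ :=
  p / (p - 1) * lp n p (dt f) ^ (-p) * Z n p f ^ (1 - (n : ℝ))

/-- `D_f^*(x) = ∫_{𝕊^{n-2}} ‖∇_ξ f‖_p^{1-n-p} |⟨x,ξ⟩|^p dξ` -/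
def Dstar (n : ℕ) (p : ℝ) (f : ℝ × EuclideanSpace ℝ (Fin (n - 1)) → ℝ)
    (x : EuclideanSpace ℝ (Fin (n - 1))) : ℝ :=
  ∫ ξ, lp n p (dxi f (ξ : EuclideanSpace ℝ (Fin (n - 1)))) ^ (1 - (n : ℝ) - p) *
      |⟪x, (ξ : EuclideanSpace ℝ (Fin (n - 1)))⟫| ^ p ∂(sphMeasure (n - 1))

/-- `C_f^*(t,x) = (α_f/p)|t|^p + D_f^*(x)` -/
def Cstar (n : ℕ) (p : ℝ) (f : ℝ × EuclideanSpace ℝ (Fin (n - 1)) → ℝ)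
    (y : ℝ × EuclideanSpace ℝ (Fin (n - 1))) : ℝ :=
  alpha n p f / p * |y.1| ^ p + Dstar n p f y.2

/-- `C_f`, the Legendre transform of `C_f^*` -/
def Cf (n : ℕ) (p : ℝ) (f : ℝ × EuclideanSpace ℝ (Fin (n - 1)) → ℝ) :
    ℝ × EuclideanSpace ℝ (Fin (n - 1)) → ℝ :=
  legendreP (Cstar n p f)

/-- the convex body `K_f = {y : C_f(y) ≤ 1}` in `ℝⁿ` -/
def Kf (n : ℕ) (p : ℝ) (f : ℝ × EuclideanSpace ℝ (Fin (n - 1)) → ℝ) :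
    Set (ℝ × EuclideanSpace ℝ (Fin (n - 1))) :=
  {y | Cf n p f y ≤ 1}

/-- the slice `K_{f,t} = {x : (t,x) ∈ K_f}` -/
def slice (n : ℕ) (p : ℝ) (f : ℝ × EuclideanSpace ℝ (Fin (n - 1)) → ℝ) (t : ℝ) :
    Set (EuclideanSpace ℝ (Fin (n - 1))) :=
  {x | (t, x) ∈ Kf n p f}

/-- the sharp constant `𝒦_n` of the `L²` Sobolev trace inequality -/
def Kn (n : ℕ) : ℝ :=
  1 / (Real.sqrt Real.pi * ((n : ℝ) - 2)) *
    (Real.Gamma n / (((n : ℝ) - 1) * Real.Gamma (((n : ℝ) - 1) / 2))) ^ (((n : ℝ) - 1)⁻¹)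

/-- the sharp constant `𝒜_{n,p}` of the affine `L^p` Sobolev trace inequality -/
def A (n : ℕ) (p : ℝ) : ℝ :=
  Real.pi ^ (-(p - 1) / 2) * ((p - 1) ^ ((p - 1) / p) / ((n : ℝ) - p)) ^ (p - 1) *
    (Real.Gamma n * Real.Gamma (((n : ℝ) + 1) / 2) /
      (((n : ℝ) - 1) * Real.Gamma (((n : ℝ) - 1) / p) *
        Real.Gamma (((n : ℝ) * (p - 1) + 1) / p))) ^ ((p - 1) / ((n : ℝ) - 1))

section Legendre

variable {m : ℕ} {p q a c : ℝ}

theorem mul_sub_mul_abs_rpow_le (hpq : p.HolderConjugate q) (ha : 0 < a) (t s : ℝ) :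
    t * s - a / p * |s| ^ p ≤ a ^ (1 - q) / q * |t| ^ q := by
  have h := Real.young_inequality (a ^ p⁻¹ * s) (a ^ (-p⁻¹) * t) hpq
  have hqp : -p⁻¹ * q = 1 - q := by
    have := hpq.symm.one_sub_inv
    have hq := hpq.symm.ne_zero
    rw [← this]
    field_simp
    ring
  rw [abs_mul, abs_mul, abs_of_pos (rpow_pos_of_pos ha _), abs_of_pos (rpow_pos_of_pos ha _),
    mul_rpow (rpow_nonneg ha.le _) (abs_nonneg _), mul_rpow (rpow_nonneg ha.le _) (abs_nonneg _),
    ← rpow_mul ha.le, ← rpow_mul ha.le, inv_mul_cancel₀ hpq.ne_zero, rpow_one, hqp,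
    mul_mul_mul_comm, ← rpow_add ha, add_neg_cancel, rpow_zero, one_mul] at h
  have e1 : a * |s| ^ p / p = a / p * |s| ^ p := by ring
  have e2 : a ^ (1 - q) * |t| ^ q / q = a ^ (1 - q) / q * |t| ^ q := by ring
  linarith

theorem exists_mul_sub_mul_abs_rpow_eq (hpq : p.HolderConjugate q) (ha : 0 < a) (t : ℝ) :
    ∃ s, t * s - a / p * |s| ^ p = a ^ (1 - q) / q * |t| ^ q := by
  have hp := hpq.ne_zero
  have hq := hpq.symm.ne_zero
  have key : ∀ r, 0 ≤ r → r * (a ^ (1 - q) * r ^ (q - 1)) -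
      a / p * |a ^ (1 - q) * r ^ (q - 1)| ^ p = a ^ (1 - q) / q * r ^ q := by
    intro r hr
    have hA := rpow_nonneg ha.le (1 - q)
    have hR := rpow_nonneg hr (q - 1)
    have e : (q - 1) * p = q := by
      rw [hpq.symm.sub_one_mul_conj]
    have e' : (1 - q) * p = -q := by linarith
    rw [abs_of_nonneg (mul_nonneg hA hR), mul_rpow hA hR, ← rpow_mul ha.le, ← rpow_mul hr, e, e']
    have h1 : r * r ^ (q - 1) = r ^ q := by
      rw [mul_comm, ← rpow_add_one' hr (by simpa using hq)]
      simp
    have h2 : a * a ^ (-q) = a ^ (1 - q) := by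
      rw [sub_eq_add_neg, rpow_add ha, rpow_one]
    have h3 : q⁻¹ = 1 - p⁻¹ := hpq.one_sub_inv.symm
    calc _ = a ^ (1 - q) * (r * r ^ (q - 1)) - (a * a ^ (-q)) * p⁻¹ * r ^ q := by ring
      _ = _ := by rw [h1, h2, div_eq_mul_inv, h3]; ring
  rcases le_total 0 t with ht | ht
  · exact ⟨a ^ (1 - q) * |t| ^ (q - 1), by simpa only [abs_of_nonneg ht] using key t ht⟩
  · refine ⟨-(a ^ (1 - q) * (-t) ^ (q - 1)), ?_⟩
    rw [abs_neg, abs_of_nonpos ht, ← key (-t) (by linarith)]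
    ring

variable {D : EuclideanSpace ℝ (Fin m) → ℝ}

theorem bddAbove_range_inner_sub (hpq : p.HolderConjugate q) (hc : 0 < c)
    (hD : ∀ z, c * ‖z‖ ^ p ≤ D z) (x : EuclideanSpace ℝ (Fin m)) :
    BddAbove (range fun z => ⟪x, z⟫ - D z) := by
  refine ⟨(c * p) ^ (1 - q) / q * |‖x‖| ^ q, ?_⟩
  rintro _ ⟨z, rfl⟩
  have h := mul_sub_mul_abs_rpow_le hpq (mul_pos hc hpq.pos) ‖x‖ ‖z‖
  rw [mul_div_cancel_right₀ _ hpq.ne_zero, abs_of_nonneg (norm_nonneg z)] at h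
  have := real_inner_le_norm x z
  have := hD z
  dsimp only
  linarith

theorem legendreP_separated (hpq : p.HolderConjugate q) (ha : 0 < a)
    (hbdd : ∀ x, BddAbove (range fun z => ⟪x, z⟫ - D z)) (t : ℝ)
    (x : EuclideanSpace ℝ (Fin m)) :
    legendreP (fun y : ℝ × EuclideanSpace ℝ (Fin m) => a / p * |y.1| ^ p + D y.2) (t, x) =
      a ^ (1 - q) / q * |t| ^ q + legendreE D x := by
  have hle : ∀ z : ℝ × EuclideanSpace ℝ (Fin m), pairP (t, x) z - (a / p * |z.1| ^ p + D z.2) ≤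
      a ^ (1 - q) / q * |t| ^ q + legendreE D x := by
    intro z
    have h1 := mul_sub_mul_abs_rpow_le hpq ha t z.1
    have h2 : ⟪x, z.2⟫ - D z.2 ≤ legendreE D x := le_ciSup (hbdd x) z.2
    simp only [pairP]
    linarith
  refine le_antisymm (ciSup_le hle) ?_
  obtain ⟨s, hs⟩ := exists_mul_sub_mul_abs_rpow_eq hpq ha t
  have : legendreE D x ≤ legendreP (fun y : ℝ × EuclideanSpace ℝ (Fin m) =>
      a / p * |y.1| ^ p + D y.2) (t, x) - a ^ (1 - q) / q * |t| ^ q := by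
    refine ciSup_le fun z => ?_
    have h := le_ciSup (f := fun z : ℝ × EuclideanSpace ℝ (Fin m) =>
      pairP (t, x) z - (a / p * |z.1| ^ p + D z.2)) ⟨_, forall_mem_range.2 hle⟩ (s, z)
    change _ ≤ legendreP _ _ at h
    simp only [pairP] at h
    linarith
  linarith

theorem legendreE_smul (hpq : p.HolderConjugate q)
    (hhom : ∀ r, 0 ≤ r → ∀ z, D (r • z) = r ^ p * D z) {r : ℝ} (hr : 0 < r)
    (x : EuclideanSpace ℝ (Fin m)) : legendreE D (r • x) = r ^ q * legendreE D x := by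
  have hr' : 0 < r ^ (q - 1) := rpow_pos_of_pos hr _
  unfold legendreE
  rw [Real.mul_iSup_of_nonneg (rpow_nonneg hr.le _),
    ← (Homeomorph.smulOfNeZero (α := EuclideanSpace ℝ (Fin m)) _ hr'.ne').surjective.iSup_comp]
  refine iSup_congr fun z => ?_
  rw [Homeomorph.smulOfNeZero_apply]
  have h1 : r * r ^ (q - 1) = r ^ q := by
    rw [mul_comm, ← rpow_add_one hr.ne']
    simp
  rw [hhom _ hr'.le, ← rpow_mul hr.le, hpq.symm.sub_one_mul_conj, inner_smul_left,
    inner_smul_right, conj_trivial, ← mul_assoc, h1, mul_sub]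

theorem legendreE_pos (hpq : p.HolderConjugate q) (hc : 0 < c)
    (hD : ∀ z, c * ‖z‖ ^ p ≤ D z)
    (hhom : ∀ r, 0 ≤ r → ∀ z, D (r • z) = r ^ p * D z) {x : EuclideanSpace ℝ (Fin m)}
    (hx : x ≠ 0) : 0 < legendreE D x := by
  have hx' : 0 < ‖x‖ := norm_pos_iff.2 hx
  have hDx : 0 < D x := lt_of_lt_of_le (mul_pos hc (rpow_pos_of_pos hx' _)) (hD x)
  have hu : 0 < ‖x‖ ^ 2 / (2 * D x) := by positivity
  set s := (‖x‖ ^ 2 / (2 * D x)) ^ (p - 1)⁻¹ with hs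
  have hs0 : 0 < s := rpow_pos_of_pos hu _
  have hsp : s ^ p = s * (‖x‖ ^ 2 / (2 * D x)) := by
    have : s ^ (p - 1) = ‖x‖ ^ 2 / (2 * D x) := by
      rw [hs, ← rpow_mul hu.le, inv_mul_cancel₀ hpq.sub_one_ne_zero, rpow_one]
    rw [← this, mul_comm, ← rpow_add_one hs0.ne', sub_add_cancel]
  have h : ⟪x, s • x⟫ - D (s • x) ≤ legendreE D x :=
    le_ciSup (bddAbove_range_inner_sub hpq hc hD x) (s • x)
  rw [hhom s hs0.le, hsp, inner_smul_right, real_inner_self_eq_norm_sq] at h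
  have e : s * ‖x‖ ^ 2 - s * (‖x‖ ^ 2 / (2 * D x)) * D x = s * ‖x‖ ^ 2 / 2 := by
    field_simp
    ring
  have : 0 < s * ‖x‖ ^ 2 / 2 := by positivity
  linarith

theorem legendreE_zero (hp : p ≠ 0) (hc : 0 < c) (hD : ∀ z, c * ‖z‖ ^ p ≤ D z)
    (hhom : ∀ r, 0 ≤ r → ∀ z, D (r • z) = r ^ p * D z) : legendreE D 0 = 0 := by
  have hneg : ∀ z : EuclideanSpace ℝ (Fin m), ⟪(0 : EuclideanSpace ℝ (Fin m)), z⟫ - D z ≤ 0 := by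
    intro z
    have := hD z
    have : 0 ≤ c * ‖z‖ ^ p := by positivity
    rw [inner_zero_left]
    linarith
  refine le_antisymm (ciSup_le hneg) ?_
  have h := le_ciSup (f := fun z : EuclideanSpace ℝ (Fin m) =>
    ⟪(0 : EuclideanSpace ℝ (Fin m)), z⟫ - D z) ⟨_, forall_mem_range.2 hneg⟩ 0
  have h0 : D 0 = 0 := by simpa [zero_rpow hp] using hhom 0 le_rfl 0
  rwa [inner_zero_left, h0, sub_zero] at h

end Legendre

section Energy

variable {n : ℕ} {p : ℝ} {f : ℝ × EuclideanSpace ℝ (Fin (n - 1)) → ℝ}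

theorem exists_fderiv_apply_ne_zero (hf : ContDiff ℝ (⊤ : ℕ∞) f) (hfc : HasCompactSupport f)
    (hf0 : ∃ y ∈ H n, f y ≠ 0) {v : ℝ × EuclideanSpace ℝ (Fin (n - 1))} (hv : v ≠ 0)
    (hv1 : 0 ≤ v.1) : ∃ y ∈ H n, fderiv ℝ f y v ≠ 0 := by
  by_contra! hzero
  obtain ⟨y, hy, hfy⟩ := hf0
  have hd : Differentiable ℝ f := hf.differentiable (by simp)
  have hray : ∀ s : ℝ, HasDerivAt (fun s : ℝ => f (y + s • v)) (fderiv ℝ f (y + s • v) v) s := by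
    intro s
    have h := ((hasDerivAt_id s).smul_const v).const_add y
    rw [one_smul] at h
    exact (hd (y + s • v)).hasFDerivAt.comp_hasDerivAt s h
  obtain ⟨R, hR⟩ := hfc.isCompact.isBounded.subset_closedBall 0
  have hvn : 0 < ‖v‖ := norm_pos_iff.2 hv
  obtain ⟨S, hS⟩ : ∃ S : ℝ, 0 < S ∧ R + ‖y‖ < S * ‖v‖ := by
    refine ⟨(|R| + ‖y‖ + 1) / ‖v‖, by positivity, ?_⟩
    rw [div_mul_cancel₀ _ hvn.ne']
    linarith [le_abs_self R]
  have hconst := constant_of_has_deriv_right_zero (f := fun s : ℝ => f (y + s • v)) (a := 0)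
    (b := S) (fun s _ => (hray s).continuousAt.continuousWithinAt) (fun s hs => by
      have h := (hray s).hasDerivWithinAt (s := Ici s)
      rwa [hzero (y + s • v) (add_pos_of_pos_of_nonneg hy (mul_nonneg hs.1 hv1))] at h)
    S ⟨hS.1.le, le_rfl⟩
  have hout : f (y + S • v) = 0 := by
    refine image_eq_zero_of_notMem_tsupport fun hmem => ?_
    have h1 := mem_closedBall_zero_iff.1 (hR hmem)
    have h2 : ‖S • v‖ ≤ ‖y + S • v‖ + ‖y‖ := by
      simpa using norm_sub_le (y + S • v) y
    rw [norm_smul, Real.norm_of_nonneg hS.1.le] at h2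
    linarith
  simp only [zero_smul, add_zero] at hconst
  exact hfy (hconst.symm.trans hout)

theorem isOpen_H : IsOpen (H n) := isOpen_lt continuous_const continuous_fst

theorem continuous_abs_fderiv_apply_rpow (hf : ContDiff ℝ (⊤ : ℕ∞) f) (hp : 0 < p) :
    Continuous fun z : (ℝ × EuclideanSpace ℝ (Fin (n - 1))) ×
      (ℝ × EuclideanSpace ℝ (Fin (n - 1))) => |fderiv ℝ f z.2 z.1| ^ p := by
  have h := hf.continuous_fderiv (by simp)
  exact ((h.comp continuous_snd).clm_apply continuous_fst).abs.rpow_const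
    fun _ => Or.inr hp.le

theorem lp_fderiv_apply_pos (hp : 0 < p) (hf : ContDiff ℝ (⊤ : ℕ∞) f)
    (hfc : HasCompactSupport f) (hf0 : ∃ y ∈ H n, f y ≠ 0)
    {v : ℝ × EuclideanSpace ℝ (Fin (n - 1))} (hv : v ≠ 0) (hv1 : 0 ≤ v.1) :
    0 < lp n p (fun y => fderiv ℝ f y v) := by
  refine rpow_pos_of_pos ?_ _
  have hcont : Continuous fun y => |fderiv ℝ f y v| ^ p :=
    (continuous_abs_fderiv_apply_rpow hf hp).comp (Continuous.prodMk_right v)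
  have hsupp : HasCompactSupport fun y => |fderiv ℝ f y v| ^ p :=
    (hfc.fderiv_apply ℝ v).comp_left (g := fun r => |r| ^ p) (by simp [hp.ne'])
  have hnn : 0 ≤ fun y => |fderiv ℝ f y v| ^ p := fun y => by positivity
  have hint := (hcont.integrable_of_hasCompactSupport hsupp (μ := volume)).integrableOn (s := H n)
  refine (integral_nonneg hnn).lt_of_ne fun h => ?_
  have hae := (integral_eq_zero_iff_of_nonneg hnn hint).1 h.symm
  have heq := Measure.eqOn_open_of_ae_eq hae isOpen_H hcont.continuousOn continuousOn_const
  obtain ⟨y, hy, hne⟩ := exists_fderiv_apply_ne_zero hf hfc hf0 hv hv1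
  exact (rpow_pos_of_pos (abs_pos.2 hne) p).ne' (heq hy)

theorem continuous_lp_fderiv_apply (hp : 0 < p) (hf : ContDiff ℝ (⊤ : ℕ∞) f)
    (hfc : HasCompactSupport f) :
    Continuous fun v => lp n p (fun y => fderiv ℝ f y v) := by
  refine Continuous.rpow_const ?_ fun _ => Or.inr (inv_nonneg.2 hp.le)
  have h := continuous_parametric_integral_of_continuous (μ := volume.restrict (H n))
    (f := fun v y => |fderiv ℝ f y v| ^ p) (continuous_abs_fderiv_apply_rpow hf hp)
    hfc.isCompact
  convert h using 2 with v
  refine (setIntegral_eq_integral_of_forall_compl_eq_zero fun y hy => ?_).symm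
  have : fderiv ℝ f y = 0 := by
    by_contra hne
    exact hy (support_fderiv_subset ℝ hne)
  simp [this, hp.ne']

theorem continuous_lp_dxi (hp : 0 < p) (hf : ContDiff ℝ (⊤ : ℕ∞) f)
    (hfc : HasCompactSupport f) : Continuous fun ξ => lp n p (dxi f ξ) :=
  (continuous_lp_fderiv_apply hp hf hfc).comp (Continuous.prodMk_right 0)

theorem lp_dxi_pos (hp : 0 < p) (hf : ContDiff ℝ (⊤ : ℕ∞) f) (hfc : HasCompactSupport f)
    (hf0 : ∃ y ∈ H n, f y ≠ 0) (ξ : Metric.sphere (0 : EuclideanSpace ℝ (Fin (n - 1))) 1) :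
    0 < lp n p (dxi f ξ) :=
  lp_fderiv_apply_pos hp hf hfc hf0 (by simp [ne_zero_of_mem_unit_sphere ξ]) le_rfl

theorem continuous_lp_dxi_rpow (hp : 0 < p) (hf : ContDiff ℝ (⊤ : ℕ∞) f)
    (hfc : HasCompactSupport f) (hf0 : ∃ y ∈ H n, f y ≠ 0) (s : ℝ) :
    Continuous fun ξ : Metric.sphere (0 : EuclideanSpace ℝ (Fin (n - 1))) 1 =>
      lp n p (dxi f ξ) ^ s :=
  ((continuous_lp_dxi hp hf hfc).comp continuous_subtype_val).rpow_const
    fun ξ => Or.inl (lp_dxi_pos hp hf hfc hf0 ξ).ne'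

instance isFiniteMeasure_sphMeasure (m : ℕ) : IsFiniteMeasure (sphMeasure m) :=
  inferInstanceAs (IsFiniteMeasure (volume : Measure (EuclideanSpace ℝ (Fin m))).toSphere)

instance isOpenPosMeasure_sphMeasure (m : ℕ) : (sphMeasure m).IsOpenPosMeasure :=
  inferInstanceAs (volume : Measure (EuclideanSpace ℝ (Fin m))).toSphere.IsOpenPosMeasure

theorem integral_sphMeasure_pos {m : ℕ}
    {g : Metric.sphere (0 : EuclideanSpace ℝ (Fin m)) 1 → ℝ} (hg : Continuous g) (hg0 : 0 ≤ g)
    {ξ : Metric.sphere (0 : EuclideanSpace ℝ (Fin m)) 1} (hξ : g ξ ≠ 0) :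
    0 < ∫ ξ, g ξ ∂(sphMeasure m) :=
  hg.integral_pos_of_hasCompactSupport_nonneg_nonzero (HasCompactSupport.of_compactSpace g) hg0 hξ

theorem alpha_pos (hn : 3 ≤ n) (hp : 1 < p) (hf : ContDiff ℝ (⊤ : ℕ∞) f)
    (hfc : HasCompactSupport f) (hf0 : ∃ y ∈ H n, f y ≠ 0) : 0 < alpha n p f := by
  have hp0 : 0 < p := one_pos.trans hp
  have : Nontrivial (EuclideanSpace ℝ (Fin (n - 1))) := by
    have : Nonempty (Fin (n - 1)) := ⟨⟨0, by omega⟩⟩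
    infer_instance
  obtain ⟨ξ⟩ : Nonempty (Metric.sphere (0 : EuclideanSpace ℝ (Fin (n - 1))) 1) :=
    (NormedSpace.sphere_nonempty.2 zero_le_one).to_subtype
  have hZ : 0 < Z n p f := rpow_pos_of_pos (integral_sphMeasure_pos
    (continuous_lp_dxi_rpow hp0 hf hfc hf0 _)
    (fun ξ => rpow_nonneg (lp_dxi_pos hp0 hf hfc hf0 ξ).le _)
    (rpow_pos_of_pos (lp_dxi_pos hp0 hf hfc hf0 ξ) _).ne') _
  have hT : 0 < lp n p (dt f) := lp_fderiv_apply_pos hp0 hf hfc hf0 (by simp) zero_le_one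
  have : 0 < p - 1 := sub_pos.2 hp
  unfold alpha
  positivity

theorem Dstar_smul (p : ℝ) (f : ℝ × EuclideanSpace ℝ (Fin (n - 1)) → ℝ) {r : ℝ} (hr : 0 ≤ r)
    (x : EuclideanSpace ℝ (Fin (n - 1))) : Dstar n p f (r • x) = r ^ p * Dstar n p f x := by
  unfold Dstar
  rw [← integral_const_mul]
  congr 1
  ext ξ
  rw [inner_smul_left, conj_trivial, abs_mul, abs_of_nonneg hr, mul_rpow hr (abs_nonneg _)]
  ring

theorem continuous_Dstar_integrand (hp : 0 < p) (hf : ContDiff ℝ (⊤ : ℕ∞) f)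
    (hfc : HasCompactSupport f) (hf0 : ∃ y ∈ H n, f y ≠ 0) :
    Continuous fun z : EuclideanSpace ℝ (Fin (n - 1)) ×
        Metric.sphere (0 : EuclideanSpace ℝ (Fin (n - 1))) 1 =>
      lp n p (dxi f (z.2 : EuclideanSpace ℝ (Fin (n - 1)))) ^ (1 - (n : ℝ) - p) *
        |⟪z.1, (z.2 : EuclideanSpace ℝ (Fin (n - 1)))⟫| ^ p := by
  refine ((continuous_lp_dxi_rpow hp hf hfc hf0 _).comp continuous_snd).mul ?_
  exact (continuous_fst.inner (continuous_subtype_val.comp continuous_snd)).abs.rpow_const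
    fun _ => Or.inr hp.le

theorem continuous_Dstar (hp : 0 < p) (hf : ContDiff ℝ (⊤ : ℕ∞) f)
    (hfc : HasCompactSupport f) (hf0 : ∃ y ∈ H n, f y ≠ 0) : Continuous (Dstar n p f) := by
  have h := continuous_parametric_integral_of_continuous (μ := sphMeasure (n - 1))
    (f := fun (x : EuclideanSpace ℝ (Fin (n - 1)))
        (ξ : Metric.sphere (0 : EuclideanSpace ℝ (Fin (n - 1))) 1) =>
      lp n p (dxi f (ξ : EuclideanSpace ℝ (Fin (n - 1)))) ^ (1 - (n : ℝ) - p) *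
        |⟪x, (ξ : EuclideanSpace ℝ (Fin (n - 1)))⟫| ^ p)
    (continuous_Dstar_integrand hp hf hfc hf0) isCompact_univ
  simp only [Measure.restrict_univ] at h
  exact h

theorem Dstar_pos (hp : 0 < p) (hf : ContDiff ℝ (⊤ : ℕ∞) f) (hfc : HasCompactSupport f)
    (hf0 : ∃ y ∈ H n, f y ≠ 0) (u : Metric.sphere (0 : EuclideanSpace ℝ (Fin (n - 1))) 1) :
    0 < Dstar n p f u := by
  have hcont := (continuous_Dstar_integrand hp hf hfc hf0).comp
    (Continuous.prodMk_right (u : EuclideanSpace ℝ (Fin (n - 1))))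
  refine integral_sphMeasure_pos hcont (ξ := u) (fun ξ => ?_) ?_
  · exact mul_nonneg (rpow_nonneg (lp_dxi_pos hp hf hfc hf0 ξ).le _)
      (rpow_nonneg (abs_nonneg _) _)
  · simpa using (rpow_pos_of_pos (lp_dxi_pos hp hf hfc hf0 u) (1 - (n : ℝ) - p)).ne'

theorem exists_mul_norm_rpow_le_Dstar (hp : 0 < p) (hf : ContDiff ℝ (⊤ : ℕ∞) f)
    (hfc : HasCompactSupport f) (hf0 : ∃ y ∈ H n, f y ≠ 0) :
    ∃ c > 0, ∀ z, c * ‖z‖ ^ p ≤ Dstar n p f z := by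
  obtain ⟨c, hc, hcD⟩ := (isCompact_sphere (0 : EuclideanSpace ℝ (Fin (n - 1))) 1)
    |>.exists_forall_le' (continuous_Dstar hp hf hfc hf0).continuousOn
      (fun u hu => Dstar_pos hp hf hfc hf0 ⟨u, hu⟩)
  refine ⟨c, hc, fun z => ?_⟩
  rcases eq_or_ne z 0 with rfl | hz
  · have := Dstar_smul p f le_rfl (0 : EuclideanSpace ℝ (Fin (n - 1)))
    simp only [zero_smul, zero_rpow hp.ne', zero_mul] at this
    simp [this, zero_rpow hp.ne']
  · have hz' : 0 < ‖z‖ := norm_pos_iff.2 hz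
    have h := hcD (‖z‖⁻¹ • z) (by simp [norm_smul, hz'.ne'])
    have e := Dstar_smul p f hz'.le (‖z‖⁻¹ • z)
    rw [smul_inv_smul₀ hz'.ne'] at e
    rw [e, mul_comm]
    gcongr

end Energy

/-- The slices of `K_f`: for `(α_f^{1-q}/q)|t|^q ≤ 1` one has
`K_{f,t} = (1 − (α_f^{1-q}/q)|t|^q)^{1/q} K_{f,0}`, and `K_{f,t} = ∅` otherwise. -/
theorem slices_of_Kf (n : ℕ) (hn : 3 ≤ n) (p q : ℝ) (hp : 1 < p) (hpn : p < n)
    (hq : q = p / (p - 1))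
    (f : ℝ × EuclideanSpace ℝ (Fin (n - 1)) → ℝ) (hf : ContDiff ℝ (⊤ : ℕ∞) f)
    (hfc : HasCompactSupport f) (hf0 : ∃ y ∈ H n, f y ≠ 0) :
    ∀ t : ℝ,
      (alpha n p f ^ (1 - q) / q * |t| ^ q ≤ 1 →
        slice n p f t =
          (1 - alpha n p f ^ (1 - q) / q * |t| ^ q) ^ q⁻¹ • slice n p f 0) ∧
      (1 < alpha n p f ^ (1 - q) / q * |t| ^ q → slice n p f t = ∅) := by
  have hpq : p.HolderConjugate q := hq ▸ HolderConjugate.conjExponent hp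
  have hp0 := hpq.pos
  have hq0 := hpq.symm.pos
  have ha := alpha_pos hn hp hf hfc hf0
  obtain ⟨c, hc, hD⟩ := exists_mul_norm_rpow_le_Dstar hp0 hf hfc hf0
  have hhom : ∀ r, 0 ≤ r → ∀ z, Dstar n p f (r • z) = r ^ p * Dstar n p f z :=
    fun r hr z => Dstar_smul p f hr z
  have hslice : ∀ t x, x ∈ slice n p f t ↔
      alpha n p f ^ (1 - q) / q * |t| ^ q + legendreE (Dstar n p f) x ≤ 1 := by
    intro t x
    rw [← legendreP_separated hpq ha (bddAbove_range_inner_sub hpq hc hD)]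
    rfl
  have hslice0 : ∀ x, x ∈ slice n p f 0 ↔ legendreE (Dstar n p f) x ≤ 1 := by
    intro x
    rw [hslice, abs_zero, zero_rpow hq0.ne', mul_zero, zero_add]
  have hzero := legendreE_zero hp0.ne' hc hD hhom
  have hnonneg : ∀ x, 0 ≤ legendreE (Dstar n p f) x := by
    intro x
    rcases eq_or_ne x 0 with rfl | hx
    · exact hzero.ge
    · exact (legendreE_pos hpq hc hD hhom hx).le
  intro t
  set b := alpha n p f ^ (1 - q) / q * |t| ^ q
  refine ⟨fun hA => ?_, fun hA => ?_⟩
  · ext x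
    rw [hslice]
    change b + _ ≤ 1 ↔ _
    rcases hA.eq_or_lt with hA | hA
    · rw [hA, sub_self, zero_rpow (inv_ne_zero hq0.ne'),
        zero_smul_set ⟨0, (hslice0 0).2 (by simp [hzero])⟩, mem_zero]
      refine ⟨fun h => ?_, ?_⟩
      · by_contra hx
        linarith [legendreE_pos hpq hc hD hhom hx]
      · rintro rfl
        simp [hzero]
    · have hb : 0 < 1 - b := sub_pos.2 hA
      have hr : 0 < (1 - b) ^ q⁻¹ := rpow_pos_of_pos hb _
      rw [mem_smul_set_iff_inv_smul_mem₀ hr.ne', hslice0,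
        legendreE_smul hpq hhom (inv_pos.2 hr), inv_rpow hr.le, ← rpow_mul hb.le,
        inv_mul_cancel₀ hq0.ne', rpow_one, inv_mul_le_iff₀ hb, mul_one]
      exact le_sub_iff_add_le'.symm
  · refine eq_empty_of_forall_notMem fun x hx => ?_
    linarith [(hslice t x).1 hx, hnonneg x]

end AffineTrace
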